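/- Let W ⊆ U be a closed linear subspace containing the range of the adjoint T* : H → U. Then the unique minimizer ū of the quadratic tracking functional J over all of U belongs to W, and ū is also the unique minimizer of J over W; in particular, the minimizer of J over U and the minimizer of J over the subspace W coincide. -/

import Mathlib

open scoped RealInnerProductSpace

theorem norm_sq_midpoint {E : Type*} [NormedAddCommGroup E] [InnerProductSpace ℝ E] (x y : E) :
    ‖(1 / 2 : ℝ) • (x + y)‖ ^ 2 = (‖x‖ ^ 2 + ‖y‖ ^ 2) / 2 - ‖x - y‖ ^ 2 / 4 := by
  rw [norm_smul, mul_pow, norm_add_sq_real, norm_sub_sq_real]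
  norm_num
  ring

/-- A minimizer of a Tikhonov functional is determined by its value. -/
theorem eq_of_tikhonov_le {U H : Type*} [NormedAddCommGroup U] [InnerProductSpace ℝ U]
    [NormedAddCommGroup H] [InnerProductSpace ℝ H] (T : U →L[ℝ] H) (d : H) {β : ℝ} (hβ : 0 < β)
    {J : U → ℝ} (hJ : ∀ u : U, J u = (1 / 2) * ‖T u - d‖ ^ 2 + (β / 2) * ‖u‖ ^ 2)
    {u v : U} (hu : ∀ w, J u ≤ J w) (hvu : J v ≤ J u) : v = u := by
  have hmid := hu ((1 / 2 : ℝ) • (v + u))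
  have hT : T ((1 / 2 : ℝ) • (v + u)) - d = (1 / 2 : ℝ) • ((T v - d) + (T u - d)) := by
    rw [map_smul, map_add]
    module
  rw [hJ ((1 / 2 : ℝ) • (v + u)), hT, norm_sq_midpoint, norm_sq_midpoint] at hmid
  have hle : β * ‖v - u‖ ^ 2 ≤ 0 := by
    have := hJ u
    have := hJ v
    nlinarith [sq_nonneg ‖T v - d - (T u - d)‖]
  have hsq : ‖v - u‖ ^ 2 = 0 := le_antisymm (nonpos_of_mul_nonpos_right hle hβ) (sq_nonneg _)
  exact sub_eq_zero.mp (norm_eq_zero.mp (pow_eq_zero_iff two_ne_zero |>.mp hsq))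

/-- An operator vanishes on the orthogonal complement of any subspace containing the range of its
adjoint. -/
theorem apply_eq_zero_of_mem_orthogonal {U H : Type*}
    [NormedAddCommGroup U] [InnerProductSpace ℝ U] [CompleteSpace U]
    [NormedAddCommGroup H] [InnerProductSpace ℝ H] [CompleteSpace H]
    (T : U →L[ℝ] H) {W : Submodule ℝ U} (hW : ∀ h : H, ContinuousLinearMap.adjoint T h ∈ W)
    {x : U} (hx : x ∈ Wᗮ) : T x = 0 := by
  rw [← inner_self_eq_zero (𝕜 := ℝ), ← ContinuousLinearMap.adjoint_inner_left]
  exact Submodule.inner_right_of_mem_orthogonal (hW _) hx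

/-- abstract form of Lemma 2.2 in the paper: if `W` is a closed subspace of `U`
containing the range of `T*`, then the unique global minimizer `ubar` of the quadratic tracking
functional `J` lies in `W`, minimizes `J` over `W`, and is the unique minimizer of `J` over `W`. -/
theorem minimizer_lies_in_reduced_control_space
    {U H : Type*} [NormedAddCommGroup U] [InnerProductSpace ℝ U] [CompleteSpace U]
    [NormedAddCommGroup H] [InnerProductSpace ℝ H] [CompleteSpace H]
    (T : U →L[ℝ] H) (d : H) (β : ℝ) (hβ : 0 < β)
    (J : U → ℝ) (hJ : ∀ u : U, J u = (1 / 2) * ‖T u - d‖ ^ 2 + (β / 2) * ‖u‖ ^ 2)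
    (W : Submodule ℝ U) (hWclosed : IsClosed (W : Set U))
    (hrange : ∀ h : H, ContinuousLinearMap.adjoint T h ∈ W)
    (ubar : U) (hmin : ∀ u : U, J ubar ≤ J u) :
    ubar ∈ W ∧ (∀ w ∈ W, J ubar ≤ J w) ∧ ∀ w ∈ W, (∀ v ∈ W, J w ≤ J v) → w = ubar := by
  have hunique : ∀ w, J w ≤ J ubar → w = ubar := fun w hw => eq_of_tikhonov_le T d hβ hJ hmin hw
  have : CompleteSpace W := hWclosed.completeSpace_coe
  have hT : T (W.starProjection ubar) = T ubar := by
    have := apply_eq_zero_of_mem_orthogonal T hrange (W.sub_starProjection_mem_orthogonal ubar)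
    rw [map_sub, sub_eq_zero] at this
    exact this.symm
  have hproj : J (W.starProjection ubar) ≤ J ubar := by
    rw [hJ, hJ, hT]
    gcongr
    exact W.norm_starProjection_apply_le ubar
  have hmem : ubar ∈ W := hunique _ hproj ▸ W.starProjection_apply_mem ubar
  exact ⟨hmem, fun w _ => hmin w, fun w _ hw => hunique w (hw ubar hmem)⟩
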